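/- Let D be a division algebra of dimension n² over an imaginary quadratic field F, and let * be an involution of the second kind on D (inducing the nontrivial automorphism of F/ℚ). Then there exists ξ ∈ D^× such that ξ* = −ξ and the involution x ↦ ξ x* ξ^{−1} is positive. -/

import Mathlib

open scoped TensorProduct

theorem aux_simple (F L D : Type*) [Field F] [Field L] [Algebra F L] [DivisionRing D] [Algebra F D]
    (hcentral : ∀ d : D, (∀ x : D, d * x = x * d) → ∃ a : F, d = algebraMap F D a) :
    IsSimpleRing (D ⊗[F] L) := by
  classical
  apply IsSimpleRing.of_eq_bot_or_eq_top
  intro I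
  by_cases hI : I = ⊥
  · exact Or.inl hI
  right
  let b0 := Module.Free.chooseBasis F L
  let B := Algebra.TensorProduct.basis D b0
  have hBL : ∀ (d : D) x i, B.repr ((d ⊗ₜ[F] (1:L)) * x) i = d * B.repr x i := by
    intro d x i
    have : (d ⊗ₜ[F] (1:L)) * x = d • x := by
      induction x with
      | zero => simp
      | add x y hx hy => rw [mul_add, hx, hy, smul_add]
      | tmul a l => simp [TensorProduct.smul_tmul']
    rw [this]; simp
  have hBR : ∀ (d : D) x i, B.repr (x * (d ⊗ₜ[F] (1:L))) i = B.repr x i * d := by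
    intro d x i
    induction x with
    | zero => simp
    | add x y hx hy => simp only [add_mul, map_add, Finsupp.add_apply, hx, hy]
    | tmul a l =>
      simp only [B, Algebra.TensorProduct.tmul_mul_tmul, mul_one,
        Algebra.TensorProduct.basis_repr_tmul, Finsupp.smul_apply, Finsupp.mapRange_apply,
        smul_eq_mul, mul_assoc, Algebra.commutes]
  have hex : ∃ k : ℕ, ∃ x ∈ I, x ≠ 0 ∧ (B.repr x).support.card = k := by
    by_contra hcon
    push Not at hcon
    apply hI
    rw [eq_bot_iff]
    intro x hx
    rw [TwoSidedIdeal.mem_bot]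
    by_contra h0
    exact hcon _ x hx h0 rfl
  obtain ⟨x, hxI, hx0, hxk⟩ := Nat.find_spec hex
  have hmin : ∀ y ∈ I, (B.repr y).support.card < (B.repr x).support.card → y = 0 := by
    intro y hy hlt
    by_contra h0
    rw [hxk] at hlt
    exact Nat.find_min hex hlt ⟨y, hy, h0, rfl⟩
  have hr0 : B.repr x ≠ 0 := by simpa using hx0
  obtain ⟨i0, hi0⟩ := Finsupp.ne_iff.mp hr0
  simp only [Finsupp.coe_zero, Pi.zero_apply] at hi0
  set c := B.repr x i0 with hc
  set y := (c⁻¹ ⊗ₜ[F] (1:L)) * x with hy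
  have hyI : y ∈ I := I.mul_mem_left _ _ hxI
  have hyr : ∀ i, B.repr y i = c⁻¹ * B.repr x i := fun i => hBL _ _ _
  have hyi0 : B.repr y i0 = 1 := by rw [hyr, ← hc, inv_mul_cancel₀ hi0]
  have hcomm : ∀ d : D, (d ⊗ₜ[F] (1:L)) * y - y * (d ⊗ₜ[F] (1:L)) = 0 := by
    intro d
    apply hmin
    · exact I.sub_mem (I.mul_mem_left _ _ hyI) (I.mul_mem_right _ _ hyI)
    · apply Finset.card_lt_card
      rw [Finset.ssubset_iff_of_subset]
      · refine ⟨i0, by simpa using hi0, ?_⟩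
        simp [hBL, hBR, hyi0]
      · intro i
        simp only [Finsupp.mem_support_iff, map_sub, Finsupp.sub_apply, hBL, hBR, hyr]
        contrapose!
        intro h
        simp [h]
  have hF : ∀ i, ∃ a : F, B.repr y i = algebraMap F D a := by
    intro i
    apply hcentral
    intro d
    have := congrArg (fun z => B.repr z i) (hcomm d)
    simp only [map_sub, Finsupp.sub_apply, hBL, hBR, map_zero, Finsupp.zero_apply] at this
    exact (sub_eq_zero.mp this).symm
  choose a ha using hF
  have hyl : y = (1:D) ⊗ₜ[F] (∑ i ∈ (B.repr y).support, a i • b0 i) := by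
    conv_lhs => rw [← B.linearCombination_repr y]
    rw [Finsupp.linearCombination_apply, Finsupp.sum, TensorProduct.tmul_sum]
    refine Finset.sum_congr rfl fun i _ => ?_
    rw [Algebra.TensorProduct.basis_repr_symm_apply', ha, TensorProduct.tmul_smul,
      TensorProduct.smul_tmul', Algebra.algebraMap_eq_smul_one]
  set l := ∑ i ∈ (B.repr y).support, a i • b0 i
  have hl : l ≠ 0 := by
    intro h
    rw [h, TensorProduct.tmul_zero] at hyl
    rw [hyl] at hyi0
    simp at hyi0
  have h1 : (1 : D ⊗[F] L) ∈ I := by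
    have := I.mul_mem_left ((1:D) ⊗ₜ[F] l⁻¹) _ hyI
    rwa [hyl, Algebra.TensorProduct.tmul_mul_tmul, inv_mul_cancel₀ hl, mul_one,
      ← Algebra.TensorProduct.one_def] at this
  rw [eq_top_iff]
  intro z _
  simpa using I.mul_mem_left z _ h1

theorem aux_matrix (F D : Type*) [Field F] [Algebra F ℂ] [DivisionRing D] [Algebra F D]
    [FiniteDimensional F D]
    (hcentral : ∀ d : D, (∀ x : D, d * x = x * d) → ∃ a : F, d = algebraMap F D a) :
    ∃ (n : ℕ) (_ : NeZero n), Nonempty (ℂ ⊗[F] D ≃ₐ[ℂ] Matrix (Fin n) (Fin n) ℂ) := by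
  have := aux_simple F ℂ D hcentral
  have : IsSimpleRing (ℂ ⊗[F] D) :=
    IsSimpleRing.of_ringEquiv (Algebra.TensorProduct.comm F D ℂ).toRingEquiv this
  exact IsSimpleRing.exists_algEquiv_matrix_of_isAlgClosed ℂ (ℂ ⊗[F] D)

theorem aux_trace_mulLeft {m : ℕ} (X : Matrix (Fin m) (Fin m) ℂ) :
    LinearMap.trace ℂ _ (LinearMap.mulLeft ℂ X) = m * X.trace := by
  rw [LinearMap.trace_eq_matrix_trace ℂ (Matrix.stdBasis ℂ (Fin m) (Fin m))]
  simp only [Matrix.trace, Matrix.diag, LinearMap.toMatrix_apply, Fintype.sum_prod_type,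
    Matrix.stdBasis_eq_single, LinearMap.mulLeft_apply]
  have : ∀ (A : Matrix (Fin m) (Fin m) ℂ) i j, (Matrix.stdBasis ℂ (Fin m) (Fin m)).repr A (i,j) = A i j := by
    intro A i j
    simp [Matrix.stdBasis]
  simp [this, Finset.mul_sum]

theorem aux_traceF (F D : Type*) [Field F] [Algebra F ℂ] [DivisionRing D] [Algebra F D]
    [FiniteDimensional F D] {m : ℕ} (e : ℂ ⊗[F] D ≃ₐ[ℂ] Matrix (Fin m) (Fin m) ℂ) (y : D) :
    algebraMap F ℂ (LinearMap.trace F D (LinearMap.mulLeft F y)) = m * (e (1 ⊗ₜ y)).trace := by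
  rw [← LinearMap.trace_baseChange, ← aux_trace_mulLeft,
    ← LinearMap.trace_conj' _ e.toLinearEquiv]
  congr 1
  ext1 X
  obtain ⟨Z, rfl⟩ := e.surjective X
  have : (LinearMap.baseChange ℂ (LinearMap.mulLeft F y)) Z = (1 ⊗ₜ y) * Z := by
    induction Z with
    | zero => simp
    | add x y hx hy => rw [mul_add, map_add, hx, hy]
    | tmul a l => simp 
  simp [LinearEquiv.conj_apply, this]


open scoped TensorProduct ComplexOrder MatrixOrder
open scoped Matrix

theorem aux_posdef {m : ℕ} (P : Matrix (Fin m) (Fin m) ℂ) (hP : P.IsHermitian)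
    (h : ∀ i j, ‖(P - 1) i j‖ < 1 / (m + 1)) : P.PosDef := by
  refine Matrix.PosDef.of_dotProduct_mulVec_pos hP fun v hv => ?_
  have him := hP.im_star_dotProduct_mulVec_self v
  have key : 0 < (star v ⬝ᵥ P *ᵥ v).re := by
    set E := P - 1 with hE
    have hPE : P = 1 + E := by simp [hE]
    have h1 : (star v ⬝ᵥ P *ᵥ v).re = ∑ i, ‖v i‖ ^ 2 + (star v ⬝ᵥ E *ᵥ v).re := by
      rw [hPE, Matrix.add_mulVec, Matrix.one_mulVec, dotProduct_add, Complex.add_re]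
      congr 1
      simp only [dotProduct, Pi.star_apply, Complex.re_sum, RCLike.star_def]
      refine Finset.sum_congr rfl fun i _ => ?_
      rw [Complex.conj_mul']
      norm_cast
    set S := ∑ i, ‖v i‖ ^ 2 with hS
    have hSpos : 0 < S := by
      obtain ⟨i, hi⟩ := Function.ne_iff.mp hv
      refine Finset.sum_pos' (fun i _ => by positivity) ⟨i, Finset.mem_univ _, ?_⟩
      have : 0 < ‖v i‖ := norm_pos_iff.mpr hi
      positivity
    have h2 : ‖star v ⬝ᵥ E *ᵥ v‖ ≤ m / (m + 1) * S := by
      simp only [dotProduct, Matrix.mulVec, Finset.mul_sum]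
      calc _ ≤ ∑ i, ∑ j, ‖star v i * (E i j * v j)‖ :=
            (norm_sum_le _ _).trans (Finset.sum_le_sum fun i _ => norm_sum_le _ _)
        _ ≤ ∑ i, ∑ j, (1 / (m + 1 : ℝ)) * ((‖v i‖ ^ 2 + ‖v j‖ ^ 2) / 2) := by
            refine Finset.sum_le_sum fun i _ => Finset.sum_le_sum fun j _ => ?_
            rw [norm_mul, norm_mul, Pi.star_apply, norm_star]
            have ha := (h i j).le
            have hb : ‖v i‖ * ‖v j‖ ≤ (‖v i‖ ^ 2 + ‖v j‖ ^ 2) / 2 := by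
              nlinarith [sq_nonneg (‖v i‖ - ‖v j‖)]
            calc _ = ‖E i j‖ * (‖v i‖ * ‖v j‖) := by ring
              _ ≤ _ := by gcongr
        _ = m / (m + 1) * S := by
            simp only [← Finset.mul_sum, ← Finset.sum_div, Finset.sum_add_distrib]
            simp only [Finset.sum_const, Finset.card_univ, Fintype.card_fin, nsmul_eq_mul,
              ← Finset.mul_sum, ← hS]
            ring
    have h3 := (abs_le.mp ((Complex.abs_re_le_norm _).trans h2)).1
    rw [h1]
    have : (m : ℝ) / (m + 1) * S < S := by
      have : (m : ℝ) / (m + 1) < 1 := by rw [div_lt_one (by positivity)]; linarith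
      nlinarith
    linarith
  rw [Complex.pos_iff]
  exact ⟨key, him.symm⟩

theorem aux_pos {m : ℕ} (P X : Matrix (Fin m) (Fin m) ℂ) (hP : P.PosDef) (hX : X ≠ 0) :
    0 < (X * P * Xᴴ * P⁻¹).trace := by
  obtain ⟨y, hy, hPy⟩ := CStarAlgebra.isStrictlyPositive_iff_eq_star_mul_self.mp
        hP.isStrictlyPositive
  obtain ⟨z, hz, hPz⟩ := CStarAlgebra.isStrictlyPositive_iff_eq_star_mul_self.mp
        hP.inv.isStrictlyPositive
  set W := z * X * yᴴ with hW
  have h1 : (X * P * Xᴴ * P⁻¹).trace = (W * Wᴴ).trace := by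
    rw [hPz, hPy, Matrix.star_eq_conjTranspose, Matrix.star_eq_conjTranspose, ← mul_assoc,
      Matrix.trace_mul_comm, hW]
    simp only [Matrix.conjTranspose_mul, Matrix.conjTranspose_conjTranspose, mul_assoc]
  have hps := Matrix.posSemidef_self_mul_conjTranspose W
  rw [h1]
  refine lt_of_le_of_ne hps.trace_nonneg ?_
  intro h0
  have hW0 := Matrix.trace_mul_conjTranspose_self_eq_zero_iff.mp h0.symm
  apply hX
  have hy' : IsUnit yᴴ := hy.star
  rw [hW, hy'.mul_left_eq_zero, hz.mul_right_eq_zero] at hW0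
  exact hW0

theorem aux_inner {m : ℕ} [NeZero m]
    (f : Matrix (Fin m) (Fin m) ℂ →ₐ[ℂ] Matrix (Fin m) (Fin m) ℂ) :
    ∃ g : Matrix (Fin m) (Fin m) ℂ, IsUnit g ∧ ∀ X, f X * g = g * X := by
  have hinj : Function.Injective f := f.toRingHom.injective
  have hsurj : Function.Surjective f :=
    (LinearMap.injective_iff_surjective (f := f.toLinearMap)).mp hinj
  let f' := AlgEquiv.ofBijective f ⟨hinj, hsurj⟩
  let t := Matrix.toLinAlgEquiv' (R := ℂ) (n := Fin m)
  obtain ⟨T, hT⟩ := AlgEquiv.eq_linearEquivConjAlgEquiv ((t.symm.trans f').trans t)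
  refine ⟨t.symm T.toLinearMap, ?_, fun X => ?_⟩
  · refine IsUnit.map t.symm ?_
    rw [Module.End.isUnit_iff]
    exact T.bijective
  · apply t.injective
    have h := congrArg (fun k => k (t X)) hT
    simp only [AlgEquiv.trans_apply, AlgEquiv.symm_apply_apply] at h
    have h' : t (f X) = (T.conjAlgEquiv ℂ) (t X) := h
    rw [map_mul, map_mul, h', AlgEquiv.apply_symm_apply]
    refine LinearMap.ext fun v => ?_
    simp [LinearEquiv.conjAlgEquiv_apply, Module.End.mul_apply]

theorem aux_det {m : ℕ} (A B : Matrix (Fin m) (Fin m) ℂ) (z : ℂ) (h : (A + z • B).det ≠ 0) :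
    ∃ k : ℕ, (A + (k : ℂ) • B).det ≠ 0 := by
  let M : Matrix (Fin m) (Fin m) (Polynomial ℂ) :=
    A.map Polynomial.C + (Polynomial.X : Polynomial ℂ) • B.map Polynomial.C
  have hM : ∀ w : ℂ, M.det.eval w = (A + w • B).det := by
    intro w
    rw [← Polynomial.coe_evalRingHom, RingHom.map_det]
    congr 1
    ext i j
    simp [M]
    ring
  by_contra hcon
  push Not at hcon
  have : M.det = 0 := by
    apply Polynomial.eq_zero_of_infinite_isRoot
    refine Set.infinite_of_injective_forall_mem (f := fun k : ℕ => (k : ℂ)) Nat.cast_injective ?_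
    intro k
    simp only [Set.mem_ofPred_eq, Polynomial.IsRoot, hM, hcon]
  apply h
  rw [← hM, this, Polynomial.eval_zero]

theorem aux_gram (F D : Type*) [Field F] [Algebra F ℂ] [DivisionRing D] [Algebra F D]
    {m : ℕ} [NeZero m] (e : ℂ ⊗[F] D ≃ₐ[ℂ] Matrix (Fin m) (Fin m) ℂ) (σ : F → F)
    (hconj : ∀ a, star (algebraMap F ℂ a) = algebraMap F ℂ (σ a))
    (s : D → D)
    (hadd : ∀ x y, s (x + y) = s x + s y)
    (hmul : ∀ x y, s (x * y) = s y * s x)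
    (hinvol : ∀ x, s (s x) = x)
    (hsecond : ∀ a : F, s (algebraMap F D a) = algebraMap F D (σ a)) :
    ∃ g : Matrix (Fin m) (Fin m) ℂ, IsUnit g ∧ gᴴ = g ∧
      ∀ d, (e (1 ⊗ₜ s d))ᴴ * g = g * e (1 ⊗ₜ d) := by
  have hs0 : s 0 = 0 := by simpa using hadd 0 0
  have hs1 : s 1 = 1 := by
    have := hmul 1 (s 1); simpa [hinvol] using this.symm
  have hcomm : ∀ a : F, (e (1 ⊗ₜ algebraMap F D a)) = algebraMap ℂ _ (algebraMap F ℂ a) := by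
    intro a
    rw [Algebra.algebraMap_eq_smul_one a, TensorProduct.tmul_smul, TensorProduct.smul_tmul',
      ← AlgEquiv.commutes e, Algebra.TensorProduct.algebraMap_apply, Algebra.algebraMap_eq_smul_one a]
    rfl
  let ψ : D →ₐ[F] Matrix (Fin m) (Fin m) ℂ :=
    { toFun := fun d => (e (1 ⊗ₜ s d))ᴴ
      map_one' := by rw [hs1, ← Algebra.TensorProduct.one_def]; simp
      map_zero' := by simp [hs0]
      map_add' := fun x y => by simp [hadd, TensorProduct.tmul_add]
      map_mul' := fun x y => by
        rw [hmul, ← Matrix.conjTranspose_mul, ← map_mul, Algebra.TensorProduct.tmul_mul_tmul,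
          mul_one]
      commutes' := fun a => by
        rw [hsecond, hcomm, ← hconj, IsScalarTower.algebraMap_apply F ℂ (Matrix _ _ ℂ)]
        rw [Matrix.algebraMap_eq_diagonal, Matrix.algebraMap_eq_diagonal, Matrix.diagonal_conjTranspose]
        congr 1
        ext i; simp }
  let Ψ : ℂ ⊗[F] D →ₐ[ℂ] Matrix (Fin m) (Fin m) ℂ :=
    Algebra.TensorProduct.lift (Algebra.ofId ℂ _) ψ (fun z d => Algebra.commutes z _)
  have hΨ : ∀ d, Ψ (1 ⊗ₜ d) = (e (1 ⊗ₜ s d))ᴴ := by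
    intro d
    have : Ψ (1 ⊗ₜ d) = (Algebra.ofId ℂ (Matrix (Fin m) (Fin m) ℂ)) 1 * ψ d :=
      Algebra.TensorProduct.lift_tmul _ _ _ _ _
    rw [this, map_one, one_mul]
    rfl
  obtain ⟨g, hg, hfg⟩ := aux_inner (Ψ.comp e.symm.toAlgHom)
  have hg1 : ∀ d, (e (1 ⊗ₜ s d))ᴴ * g = g * e (1 ⊗ₜ d) := by
    intro d
    have := hfg (e (1 ⊗ₜ d))
    rw [← hΨ]
    simpa using this
  have hg2 : ∀ d, (e (1 ⊗ₜ s d))ᴴ * gᴴ = gᴴ * e (1 ⊗ₜ d) := by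
    intro d
    have := congrArg Matrix.conjTranspose (hg1 (s d))
    simp only [Matrix.conjTranspose_mul, Matrix.conjTranspose_conjTranspose, hinvol] at this
    exact this.symm
  obtain ⟨k, hk⟩ := aux_det (g + gᴴ) (Complex.I • (g - gᴴ)) (-Complex.I) (by
    have : g + gᴴ + -Complex.I • Complex.I • (g - gᴴ) = (2:ℂ) • g := by
      rw [smul_smul, neg_mul, Complex.I_mul_I, neg_neg, one_smul, two_smul]; abel
    rw [this, Matrix.det_smul]
    exact mul_ne_zero (by simp) ((Matrix.isUnit_iff_isUnit_det _).mp hg).ne_zero)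
  refine ⟨_, (Matrix.isUnit_iff_isUnit_det _).mpr hk.isUnit, ?_, ?_⟩
  · simp only [Matrix.conjTranspose_add, Matrix.conjTranspose_smul, Matrix.conjTranspose_sub,
      Matrix.conjTranspose_conjTranspose, star_natCast]
    rw [add_comm gᴴ g]
    congr 2
    rw [← neg_sub g, smul_neg]
    simp
  · intro d
    simp only [mul_add, add_mul, mul_sub, sub_mul, Matrix.mul_smul, Matrix.smul_mul, hg1, hg2]

theorem aux_dense (F D : Type*) [Field F] [Algebra F ℂ] [DivisionRing D] [Algebra F D]
    {m : ℕ} (e : ℂ ⊗[F] D ≃ₐ[ℂ] Matrix (Fin m) (Fin m) ℂ)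
    (hdense : DenseRange (algebraMap F ℂ)) :
    DenseRange (fun d : D => e (1 ⊗ₜ d)) := by
  let R : AddSubgroup (Matrix (Fin m) (Fin m) ℂ) :=
    { carrier := Set.range (fun d : D => e (1 ⊗ₜ d))
      zero_mem' := ⟨0, by simp⟩
      add_mem' := by
        rintro _ _ ⟨x, rfl⟩ ⟨y, rfl⟩
        exact ⟨x + y, by simp [TensorProduct.tmul_add]⟩
      neg_mem' := by
        rintro _ ⟨x, rfl⟩
        exact ⟨-x, by simp [TensorProduct.tmul_neg]⟩ }
  have key : ∀ Z, e Z ∈ R.topologicalClosure := by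
    intro Z
    induction Z with
    | zero => simp
    | add x y hx hy => rw [map_add]; exact add_mem hx hy
    | tmul z d =>
      have h1 : e (z ⊗ₜ d) = z • e (1 ⊗ₜ d) := by
        rw [← map_smul, TensorProduct.smul_tmul', smul_eq_mul, mul_one]
      rw [h1]
      have hc : IsClosed {z : ℂ | z • e (1 ⊗ₜ d) ∈ R.topologicalClosure} :=
        R.isClosed_topologicalClosure.preimage (continuous_id.smul continuous_const)
      refine hdense.induction_on (p := fun z => z • e (1 ⊗ₜ d) ∈ R.topologicalClosure) z hc ?_
      intro a
      apply R.le_topologicalClosure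
      refine ⟨a • d, ?_⟩
      simp only
      rw [← map_smul, TensorProduct.smul_tmul', TensorProduct.tmul_smul, TensorProduct.smul_tmul',
        Algebra.smul_def, smul_eq_mul]
  intro X
  obtain ⟨Z, rfl⟩ := e.surjective X
  exact key Z

set_option maxHeartbeats 1000000 in
theorem aux_main (F D : Type*) [Field F] [Algebra F ℂ] [DivisionRing D] [Algebra F D]
    [FiniteDimensional F D]
    (hcentral : ∀ d : D, (∀ x : D, d * x = x * d) → ∃ a : F, d = algebraMap F D a)
    (σ : F → F)
    (hconj : ∀ a, star (algebraMap F ℂ a) = algebraMap F ℂ (σ a))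
    (hdense : DenseRange (algebraMap F ℂ))
    (s : D → D)
    (hadd : ∀ x y, s (x + y) = s x + s y)
    (hmul : ∀ x y, s (x * y) = s y * s x)
    (hinvol : ∀ x, s (s x) = x)
    (hsecond : ∀ a : F, s (algebraMap F D a) = algebraMap F D (σ a)) :
    ∃ b : D, b ≠ 0 ∧ s b = b ∧ ∀ x : D, x ≠ 0 →
      0 < algebraMap F ℂ (LinearMap.trace F D (LinearMap.mulLeft F (x * (b * s x * b⁻¹)))) := by
  obtain ⟨m, hm, ⟨e⟩⟩ := aux_matrix F D hcentral
  obtain ⟨g, hgu, hgH, hg⟩ := aux_gram F D e σ hconj s hadd hmul hinvol hsecond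
  have hdet : IsUnit g.det := (Matrix.isUnit_iff_isUnit_det _).mp hgu
  have hgi : g * g⁻¹ = 1 := Matrix.mul_nonsing_inv _ hdet
  have hig : g⁻¹ * g = 1 := Matrix.nonsing_inv_mul _ hdet
  have hgiH : (g⁻¹)ᴴ = g⁻¹ := by rw [Matrix.conjTranspose_nonsing_inv, hgH]
  let I : D →+* Matrix (Fin m) (Fin m) ℂ :=
    (e.toRingEquiv.toRingHom).comp (Algebra.TensorProduct.includeRight (R := F) (A := ℂ)).toRingHom
  have hI : ∀ d, I d = e (1 ⊗ₜ d) := fun d => rfl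
  have hs : ∀ d, I (s d) = g⁻¹ * (I d)ᴴ * g := by
    intro d
    have := hg (s d)
    rw [hinvol, ← hI, ← hI] at this
    rw [mul_assoc, this, ← mul_assoc, hig, one_mul]
  -- approximate
  let Φ : Matrix (Fin m) (Fin m) ℂ → Matrix (Fin m) (Fin m) ℂ :=
    fun Y => (1/2 : ℂ) • (Y + g⁻¹ * Yᴴ * g) * g⁻¹ - 1
  have hΦc : Continuous Φ := by
    have h1 : Continuous fun Y : Matrix (Fin m) (Fin m) ℂ => Yᴴ := continuous_id.matrix_conjTranspose
    have h2 : Continuous fun Y : Matrix (Fin m) (Fin m) ℂ => Y + g⁻¹ * Yᴴ * g :=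
      continuous_id.add ((continuous_const.matrix_mul h1).matrix_mul continuous_const)
    exact ((h2.const_smul (1/2 : ℂ)).matrix_mul continuous_const).sub continuous_const
  have hΦg : Φ g = 0 := by
    simp only [Φ, hgH, hig, one_mul]
    rw [← two_smul ℂ g, smul_smul]
    norm_num [hgi]
  let U : Set (Matrix (Fin m) (Fin m) ℂ) := {Y | ∀ i j, ‖Φ Y i j‖ < 1 / (m + 1)}
  have hU : IsOpen U := by
    simp only [U, Set.ofPred_forall]
    refine isOpen_iInter_of_finite fun i => isOpen_iInter_of_finite fun j => ?_
    exact isOpen_lt ((hΦc.matrix_elem i j).norm) continuous_const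
  have hgU : g ∈ U := by
    intro i j
    rw [hΦg]
    simp only [Matrix.zero_apply, norm_zero]
    positivity
  obtain ⟨d, hd⟩ := (aux_dense F D e hdense).exists_mem_open hU ⟨g, hgU⟩
  have h2 : (algebraMap ℂ (Matrix (Fin m) (Fin m) ℂ)) 2 = I 2 := by
    rw [map_ofNat, map_ofNat]
  have hD2 : (2 : D) ≠ 0 := by
    intro h
    rw [h, map_zero] at h2
    simp at h2
  have hs1 : s 1 = 1 := by
    have := hmul 1 (s 1); simpa [hinvol] using this.symm
  have hs2 : s 2 = 2 := by
    rw [← one_add_one_eq_two, hadd, hs1]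
  have hcom2 : ∀ x : D, Commute x 2 := fun x => Nat.cast_ofNat (R := D) (n := 2) ▸ Nat.commute_cast x 2
  have hs2i : s 2⁻¹ = 2⁻¹ := by
    have := hmul 2 2⁻¹
    rw [mul_inv_cancel₀ hD2, hs1, hs2] at this
    exact eq_inv_of_mul_eq_one_left this.symm
  let b : D := 2⁻¹ * (d + s d)
  have hsb : s b = b := by
    simp only [b]
    rw [hmul, hs2i, hadd, hinvol, add_comm (s d)]
    exact ((hcom2 _).inv_right₀).eq
  have hIb : I b = (1/2 : ℂ) • (I d + g⁻¹ * (I d)ᴴ * g) := by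
    have : I 2 * I b = I d + g⁻¹ * (I d)ᴴ * g := by
      rw [← map_mul, ← hs, ← map_add]
      simp only [b]
      rw [mul_inv_cancel_left₀ hD2]
    rw [← this, ← h2, ← Algebra.smul_def, smul_smul]
    norm_num
  set P := I b * g⁻¹ with hP
  have hPH : P.IsHermitian := by
    have := hs b
    rw [hsb] at this
    rw [Matrix.IsHermitian, hP, Matrix.conjTranspose_mul, hgiH]
    conv_rhs => rw [this, mul_assoc, hgi, mul_one]
  have hPd : P.PosDef := by
    apply aux_posdef P hPH
    intro i j
    have := hd i j
    simp only [Φ] at this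
    rw [← hI, ← hIb] at this
    exact this
  have hb0 : b ≠ 0 := by
    intro h
    have := hPd.isUnit
    rw [hP, h, map_zero, zero_mul] at this
    simp at this
  refine ⟨b, hb0, hsb, fun x hx => ?_⟩
  rw [aux_traceF F D e, ← hI]
  have hPi : P⁻¹ = g * I b⁻¹ := by
    apply Matrix.inv_eq_right_inv
    rw [hP, mul_assoc, ← mul_assoc g⁻¹, hig, one_mul, ← map_mul, mul_inv_cancel₀ hb0, map_one]
  have heq : I (x * (b * s x * b⁻¹)) = I x * P * (I x)ᴴ * P⁻¹ := by
    rw [hPi, hP, map_mul, map_mul, map_mul, hs]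
    simp only [mul_assoc]
  rw [heq]
  have := aux_pos P (I x) hPd (by simpa using hx)
  have hm0 : (0:ℂ) < m := by exact_mod_cast Nat.pos_of_ne_zero hm.out
  exact mul_pos hm0 this

theorem aux_tower (F D : Type*) [Field F] [Algebra ℚ F] [FiniteDimensional ℚ F]
    [DivisionRing D] [Algebra F D] [Algebra ℚ D] [IsScalarTower ℚ F D]
    [FiniteDimensional F D] (y : D) :
    LinearMap.trace ℚ D (LinearMap.mulLeft ℚ y) =
        Algebra.trace ℚ F (LinearMap.trace F D (LinearMap.mulLeft F y)) := by
  classical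
  let b := Module.Free.chooseBasis ℚ F
  let c := Module.Free.chooseBasis F D
  rw [LinearMap.trace_eq_matrix_trace ℚ (b.smulTower c), LinearMap.trace_eq_matrix_trace F c,
    Algebra.trace_eq_matrix_trace b]
  simp only [Matrix.trace, Matrix.diag, Fintype.sum_prod_type, LinearMap.toMatrix_apply,
    Algebra.leftMulMatrix_eq_repr_mul, LinearMap.mulLeft_apply, Module.Basis.smulTower_repr,
    Module.Basis.smulTower_apply, Finset.sum_mul, map_sum, Finsupp.coe_finset_sum, Finset.sum_apply]
  refine Finset.sum_congr rfl fun i _ => Finset.sum_congr rfl fun j _ => ?_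
  rw [mul_smul_comm, map_smul, Finsupp.smul_apply, smul_eq_mul, mul_comm]

theorem stmt_9
    (F : Type*) [Field F] [Algebra ℚ F] [FiniteDimensional ℚ F]
    (hF2 : Module.finrank ℚ F = 2)
    (himag : IsEmpty (F →+* ℝ))
    (σ : F ≃ₐ[ℚ] F) (hσ : σ ≠ (AlgEquiv.refl : F ≃ₐ[ℚ] F))
    (D : Type*) [DivisionRing D] [Algebra F D] [Algebra ℚ D] [IsScalarTower ℚ F D]
    [FiniteDimensional ℚ D]
    {n : ℕ} (hn : 0 < n) (hD : Module.finrank F D = n ^ 2)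
    -- D is central over F
    (hcentral : ∀ d : D, (∀ x : D, d * x = x * d) → ∃ a : F, d = algebraMap F D a)
    -- the involution `*` of the second kind
    (s : D → D)
    (hadd : ∀ x y, s (x + y) = s x + s y)
    (hmul : ∀ x y, s (x * y) = s y * s x)
    (hinvol : ∀ x, s (s x) = x)
    (hsecond : ∀ a : F, s (algebraMap F D a) = algebraMap F D (σ a)) :
    ∃ ξ : D, ξ ≠ 0 ∧ s ξ = -ξ ∧
      ∀ x : D, x ≠ 0 →
        0 < LinearMap.trace ℚ D (LinearMap.mulLeft ℚ (x * (ξ * s x * ξ⁻¹))) := by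
  classical
  have hFD : FiniteDimensional F D := Module.Finite.right ℚ F D
  have hcard : Fintype.card (F →ₐ[ℚ] ℂ) = 2 := by rw [AlgHom.card, hF2]
  obtain ⟨φ⟩ : Nonempty (F →ₐ[ℚ] ℂ) := Fintype.card_pos_iff.mp (by omega)
  have hnr : ¬ ∀ a, ∃ r : ℝ, (r : ℂ) = φ a := by
    intro h
    have hre : ∀ a, ((φ a).re : ℂ) = φ a := by
      intro a; obtain ⟨r, hr⟩ := h a; rw [← hr]; simp
    refine himag.false
      { toFun := fun a => (φ a).re
        map_one' := by simp
        map_zero' := by simp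
        map_add' := fun x y => by simp
        map_mul' := fun x y => by
          have : ((φ (x * y)).re : ℂ) = ((φ x).re : ℂ) * ((φ y).re : ℂ) := by
            rw [hre, hre, hre, map_mul]
          exact_mod_cast this }
  let φc : F →ₐ[ℚ] ℂ := { (starRingEnd ℂ).comp φ.toRingHom with
    commutes' := fun r => by simp }
  have hφc : ∀ a, φc a = star (φ a) := fun a => rfl
  let φσ : F →ₐ[ℚ] ℂ := φ.comp σ.toAlgHom
  have hφσ : ∀ a, φσ a = φ (σ a) := fun a => rfl
  have h1 : φ ≠ φc := by
    intro h
    apply hnr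
    intro a
    have : φ a = star (φ a) := by rw [← hφc, ← h]
    exact ⟨(φ a).re, Complex.conj_eq_iff_re.mp this.symm⟩
  have h2 : φ ≠ φσ := by
    intro h
    apply hσ
    ext a
    apply φ.toRingHom.injective
    exact (DFunLike.congr_fun h a).symm
  have huniv : (Finset.univ : Finset (F →ₐ[ℚ] ℂ)) = {φ, φc} := by
    symm
    apply Finset.eq_univ_of_card
    rw [Finset.card_pair h1, hcard]
  have h3 : φc = φσ := by
    have : φσ ∈ ({φ, φc} : Finset (F →ₐ[ℚ] ℂ)) := huniv ▸ Finset.mem_univ _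
    simp only [Finset.mem_insert, Finset.mem_singleton] at this
    rcases this with h | h
    · exact absurd h.symm h2
    · exact h.symm
  have hconj : ∀ a, star (φ a) = φ (σ a) := fun a => by rw [← hφc, h3, hφσ]
  have hσσ : ∀ a, σ (σ a) = a := fun a => φ.toRingHom.injective (by
    change φ (σ (σ a)) = φ a
    rw [← hconj, ← hconj, star_star])
  letI : Algebra F ℂ := φ.toRingHom.toAlgebra
  have halg : ∀ a, algebraMap F ℂ a = φ a := fun a => rfl
  have hdense : DenseRange (algebraMap F ℂ) := by
    have hcl := Complex.subfield_eq_of_closed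
      (Subfield.isClosed_topologicalClosure φ.toRingHom.fieldRange)
    rcases hcl with h | h
    · exfalso
      apply hnr
      intro a
      have : φ a ∈ φ.toRingHom.fieldRange.topologicalClosure :=
        Subfield.le_topologicalClosure _ ⟨a, rfl⟩
      rw [h] at this
      exact this
    · intro z
      have : z ∈ φ.toRingHom.fieldRange.topologicalClosure := by rw [h]; trivial
      exact this
  obtain ⟨b, hb0, hsb, hpos⟩ := aux_main F D hcentral σ hconj hdense s hadd hmul hinvol hsecond
  obtain ⟨a, ha⟩ : ∃ a, σ a ≠ a := by
    by_contra hcon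
    push Not at hcon
    exact hσ (AlgEquiv.ext hcon)
  set ε := a - σ a with hε
  have hε0 : ε ≠ 0 := sub_ne_zero.mpr ha.symm
  have hσε : σ ε = -ε := by rw [hε, map_sub, hσσ]; ring
  have hE0 : algebraMap F D ε ≠ 0 := by simpa using hε0
  refine ⟨algebraMap F D ε * b, mul_ne_zero hE0 hb0, ?_, ?_⟩
  · rw [hmul, hsb, hsecond, hσε, map_neg, mul_neg, Algebra.commutes]
  · intro x hx
    have hcx : algebraMap F D ε * b * s x * (algebraMap F D ε * b)⁻¹ = b * s x * b⁻¹ := by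
      rw [mul_inv_rev, mul_assoc (algebraMap F D ε), mul_assoc (algebraMap F D ε), ← mul_assoc _ b⁻¹,
        Algebra.commutes ε, mul_assoc, inv_mul_cancel₀ hE0, mul_one]
    rw [hcx]
    have hp := hpos x hx
    set y := x * (b * s x * b⁻¹)
    have ht : LinearMap.trace ℚ D (LinearMap.mulLeft ℚ y) =
        Algebra.trace ℚ F (LinearMap.trace F D (LinearMap.mulLeft F y)) :=
      aux_tower F D y
    rw [ht]
    set t := LinearMap.trace F D (LinearMap.mulLeft F y)
    rw [halg, Complex.pos_iff] at hp
    have hsum := trace_eq_sum_embeddings (K := ℚ) (L := F) ℂ (x := t)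
    rw [huniv, Finset.sum_pair h1, hφc] at hsum
    have hre := congrArg Complex.re hsum
    simp only [eq_ratCast, Complex.ratCast_re, Complex.add_re, RCLike.star_def, Complex.conj_re] at hre
    have : (0:ℝ) < (Algebra.trace ℚ F t : ℚ) := by rw [hre]; linarith [hp.1]
    exact_mod_cast this
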